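/- Positive curvature of (M(ℝ^d), WOP) in the sense of Alexandrov: for all μ₀, μ₁ ∈ M(ℝ^d) with m_{μ₀} + m_{μ₁} > 0 and all t ∈ [0,1], the point μ_t := m_t·μ̂_{λ_t} of the WOP-geodesic from μ₀ to μ₁ (with m_t := (1−t)m_{μ₀}+t·m_{μ₁}, λ_t := t·m_{μ₁}/m_t, and μ̂ a constant-speed W₂-geodesic from μ̄₀ to μ̄₁ induced by an optimal coupling) satisfies, for every η ∈ M(ℝ^d), WOP²(μ_t, η) ≥ (1−t)·WOP²(μ₀, η) + t·WOP²(μ₁, η) − t(1−t)·WOP²(μ₀, μ₁). -/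

import Mathlib

open MeasureTheory

noncomputable section

abbrev Euc (d : ℕ) := EuclideanSpace ℝ (Fin d)

variable {d : ℕ}

/-- Total mass of a measure. -/
def mass (μ : Measure (Euc d)) : ℝ := (μ Set.univ).toReal

/-- Second moment centered at `x₀`. -/
def sndMoment (x₀ : Euc d) (μ : Measure (Euc d)) : ℝ := ∫ x, ‖x - x₀‖ ^ 2 ∂μ

/-- `μ ∈ M(ℝ^d)`: finite positive measure with finite second moment. -/
def MemM (μ : Measure (Euc d)) : Prop :=
  IsFiniteMeasure μ ∧ Integrable (fun x => ‖x‖ ^ 2) μ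

/-- `μ ∈ P₂(ℝ^d)`: probability measure with finite second moment. -/
def MemP2 (μ : Measure (Euc d)) : Prop :=
  IsProbabilityMeasure μ ∧ Integrable (fun x => ‖x‖ ^ 2) μ

/-- Squared 2-Wasserstein distance, as an infimum over couplings. -/
def W2sq (μ ν : Measure (Euc d)) : ℝ :=
  sInf { r : ℝ | ∃ π : Measure (Euc d × Euc d),
    π.map Prod.fst = μ ∧ π.map Prod.snd = ν ∧ r = ∫ p, ‖p.1 - p.2‖ ^ 2 ∂π }

/-- 2-Wasserstein distance. -/
def W2 (μ ν : Measure (Euc d)) : ℝ := Real.sqrt (W2sq μ ν)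

/-- The dilation `T_a(x) = a (x - x₀) + x₀`. -/
def dil (x₀ : Euc d) (a : ℝ) (x : Euc d) : Euc d := a • (x - x₀) + x₀

/-- Normalization `μ̄` of `μ`, with the convention `μ̄ = δ_{x₀}` for the null measure. -/
def nm (x₀ : Euc d) (μ : Measure (Euc d)) : Measure (Euc d) :=
  if μ Set.univ = 0 then Measure.dirac x₀ else (μ Set.univ)⁻¹ • μ

/-- Squared WOP metric with reference point `x₀`. -/
def WOP2 (x₀ : Euc d) (μ ν : Measure (Euc d)) : ℝ :=
  (mass μ - mass ν) ^ 2 +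
    W2sq ((nm x₀ μ).map (dil x₀ (mass μ))) ((nm x₀ ν).map (dil x₀ (mass ν)))

/-- The WOP metric with reference point `x₀`. -/
def WOP (x₀ : Euc d) (μ ν : Measure (Euc d)) : ℝ := Real.sqrt (WOP2 x₀ μ ν)


/-- The candidate geodesic `μ_t = m_t · μ̂_{λ_t}` built from an optimal coupling `π`
of the normalized measures: `μ̂_s = P_s # π` with `P_s(x,y) = (1-s)x + s y`,
`m_t = (1-t) m_{μ₀} + t m_{μ₁}` and `λ_t = t m_{μ₁} / m_t`. -/
def geoCurve (μ₀ μ₁ : Measure (Euc d)) (π : Measure (Euc d × Euc d)) (t : ℝ) :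
    Measure (Euc d) :=
  ENNReal.ofReal ((1 - t) * mass μ₀ + t * mass μ₁) •
    π.map (fun p =>
      (1 - t * mass μ₁ / ((1 - t) * mass μ₀ + t * mass μ₁)) • p.1
        + (t * mass μ₁ / ((1 - t) * mass μ₀ + t * mass μ₁)) • p.2)

/-- Lifting of a coupling of `μ.map f` and `ν` along `f` in the first coordinate. -/
theorem exists_lift_fst {Ω E F : Type*} [MeasurableSpace Ω] [MeasurableSpace E]
    [MeasurableSpace F] [StandardBorelSpace F] [Nonempty F]
    {μ : Measure Ω} [IsFiniteMeasure μ] {σ : Measure (E × F)} [IsFiniteMeasure σ]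
    {f : Ω → E} (hf : Measurable f) (h : σ.map Prod.fst = μ.map f) :
    ∃ ρ : Measure (Ω × F), ρ.map Prod.fst = μ ∧ ρ.map (Prod.map f id) = σ := by
  refine ⟨μ.compProd (σ.condKernel.comap f hf), Measure.fst_compProd _ _, ?_⟩
  refine Measure.ext fun s hs => ?_
  have hfid : Measurable (Prod.map f (id : F → F)) := hf.prodMap measurable_id
  rw [Measure.map_apply hfid hs, Measure.compProd_apply (hfid hs)]
  conv_rhs => rw [← σ.disintegrate σ.condKernel, Measure.compProd_apply hs, Measure.fst, h,
    lintegral_map (ProbabilityTheory.Kernel.measurable_kernel_prodMk_left hs) hf]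
  rfl

/-- Lifting of a coupling of `μ.map f` and `ν.map g` to a coupling of `μ` and `ν`. -/
theorem exists_lift_coupling {Ω Ω' E F : Type*} [MeasurableSpace Ω] [MeasurableSpace Ω']
    [MeasurableSpace E] [MeasurableSpace F] [StandardBorelSpace Ω] [Nonempty Ω]
    [StandardBorelSpace F] [Nonempty F]
    {μ : Measure Ω} [IsFiniteMeasure μ] {ν : Measure Ω'} [IsFiniteMeasure ν]
    {σ : Measure (E × F)} [IsFiniteMeasure σ]
    {f : Ω → E} {g : Ω' → F} (hf : Measurable f) (hg : Measurable g)
    (h₁ : σ.map Prod.fst = μ.map f) (h₂ : σ.map Prod.snd = ν.map g) :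
    ∃ ρ : Measure (Ω × Ω'), ρ.map Prod.fst = μ ∧ ρ.map Prod.snd = ν ∧
      ρ.map (Prod.map f g) = σ := by
  obtain ⟨ρ, hρ₁, hρ₂⟩ := exists_lift_fst hf h₁
  have hρfin : IsFiniteMeasure ρ := by
    have : IsFiniteMeasure (ρ.map Prod.fst) := hρ₁ ▸ inferInstance
    exact Measure.isFiniteMeasure_of_map measurable_fst.aemeasurable
  have hswap : (ρ.map Prod.swap).map Prod.fst = ν.map g := by
    rw [← h₂, ← hρ₂, Measure.map_map measurable_fst measurable_swap,
      Measure.map_map measurable_snd (hf.prodMap measurable_id)]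
    rfl
  obtain ⟨τ, hτ₁, hτ₂⟩ := exists_lift_fst hg hswap
  refine ⟨τ.map Prod.swap, ?_, ?_, ?_⟩
  · rw [Measure.map_map measurable_fst measurable_swap, ← hρ₁]
    have := congrArg (Measure.map Prod.snd) hτ₂
    rw [Measure.map_map measurable_snd (hg.prodMap measurable_id),
      Measure.map_map measurable_snd measurable_swap] at this
    exact this
  · rw [Measure.map_map measurable_snd measurable_swap]
    exact hτ₁
  · rw [← hρ₂, Measure.map_map (hf.prodMap hg) measurable_swap]
    have := congrArg (Measure.map (Prod.map f id ∘ Prod.swap)) hτ₂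
    rw [Measure.map_map ((hf.prodMap measurable_id).comp measurable_swap)
        (hg.prodMap measurable_id),
      Measure.map_map ((hf.prodMap measurable_id).comp measurable_swap) measurable_swap] at this
    exact this

theorem W2sq_map_le {Ω : Type*} [MeasurableSpace Ω] (ρ : Measure Ω) {f g : Ω → Euc d}
    (hf : Measurable f) (hg : Measurable g) :
    W2sq (ρ.map f) (ρ.map g) ≤ ∫ ω, ‖f ω - g ω‖ ^ 2 ∂ρ := by
  refine csInf_le ⟨0, ?_⟩ ⟨ρ.map fun ω => (f ω, g ω), ?_, ?_, ?_⟩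
  · rintro r ⟨π, -, -, rfl⟩
    exact integral_nonneg fun p => by positivity
  · rw [Measure.map_map measurable_fst (hf.prodMk hg)]
    rfl
  · rw [Measure.map_map measurable_snd (hf.prodMk hg)]
    rfl
  · rw [integral_map (hf.prodMk hg).aemeasurable]
    exact (by fun_prop : Continuous fun p : Euc d × Euc d => ‖p.1 - p.2‖ ^ 2).aestronglyMeasurable

theorem le_W2sq {μ ν : Measure (Euc d)} [IsProbabilityMeasure μ] [IsProbabilityMeasure ν] {c : ℝ}
    (h : ∀ π : Measure (Euc d × Euc d), IsProbabilityMeasure π → π.map Prod.fst = μ →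
      π.map Prod.snd = ν → c ≤ ∫ p, ‖p.1 - p.2‖ ^ 2 ∂π) :
    c ≤ W2sq μ ν := by
  refine le_csInf ⟨_, μ.prod ν, ?_, ?_, rfl⟩ ?_
  · rw [Measure.map_fst_prod, measure_univ, one_smul]
  · rw [Measure.map_snd_prod, measure_univ, one_smul]
  · rintro r ⟨π, hπ₁, hπ₂, rfl⟩
    have : IsProbabilityMeasure (π.map Prod.fst) := hπ₁ ▸ inferInstance
    exact h π (Measure.isProbabilityMeasure_of_map Prod.fst) hπ₁ hπ₂

theorem measurable_dil (x₀ : Euc d) (a : ℝ) : Measurable (dil x₀ a) := by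
  unfold dil
  fun_prop

theorem memLp_dil {Ω : Type*} [MeasurableSpace Ω] {ρ : Measure Ω} [IsFiniteMeasure ρ]
    {f : Ω → Euc d} (hf : MemLp f 2 ρ) (x₀ : Euc d) (a : ℝ) :
    MemLp (fun ω => dil x₀ a (f ω)) 2 ρ :=
  ((hf.sub (memLp_const x₀)).const_smul a).add (memLp_const x₀)

theorem memLp_id_of_integrable {μ : Measure (Euc d)} (h : Integrable (fun x => ‖x‖ ^ 2) μ) :
    MemLp id 2 μ :=
  (memLp_two_iff_integrable_sq_norm continuous_id.aestronglyMeasurable).2 h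

theorem memLp_of_map_eq {Ω : Type*} [MeasurableSpace Ω] {ρ : Measure Ω} {μ : Measure (Euc d)}
    {f : Ω → Euc d} (hf : Measurable f) (h : ρ.map f = μ) (hμ : MemLp id 2 μ) :
    MemLp f 2 ρ := by
  subst h
  exact (memLp_map_measure_iff hμ.1 hf.aemeasurable).1 hμ

theorem integrable_norm_sub_sq {Ω : Type*} [MeasurableSpace Ω] {ρ : Measure Ω}
    {f g : Ω → Euc d} (hf : MemLp f 2 ρ) (hg : MemLp g 2 ρ) :
    Integrable (fun ω => ‖f ω - g ω‖ ^ 2) ρ :=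
  (memLp_two_iff_integrable_sq_norm (hf.sub hg).1).1 (hf.sub hg)

theorem norm_dil_sub_dil_sq (x₀ : Euc d) (a b : ℝ) (x y : Euc d) :
    ‖dil x₀ a x - dil x₀ b y‖ ^ 2 =
      a * (a - b) * ‖x - x₀‖ ^ 2 + b * (b - a) * ‖y - x₀‖ ^ 2 + a * b * ‖x - y‖ ^ 2 := by
  have h₁ : dil x₀ a x - dil x₀ b y = a • (x - x₀) - b • (y - x₀) := by
    unfold dil
    abel
  have h₂ : x - y = (x - x₀) - (y - x₀) := by abel
  rw [h₁, h₂, norm_sub_sq_real (a • _), norm_sub_sq_real (x - x₀), norm_smul, norm_smul, real_inner_smul_left,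
    real_inner_smul_right, mul_pow, mul_pow, Real.norm_eq_abs, Real.norm_eq_abs, sq_abs, sq_abs]
  ring

theorem integral_norm_dil_sub_dil_sq {μ ν : Measure (Euc d)} (hμ : MemLp id 2 μ)
    (hν : MemLp id 2 ν) {π : Measure (Euc d × Euc d)} [IsFiniteMeasure π]
    (hπ₁ : π.map Prod.fst = μ) (hπ₂ : π.map Prod.snd = ν) (x₀ : Euc d) (a b : ℝ) :
    ∫ p, ‖dil x₀ a p.1 - dil x₀ b p.2‖ ^ 2 ∂π =
      a * (a - b) * sndMoment x₀ μ + b * (b - a) * sndMoment x₀ ν +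
        a * b * ∫ p, ‖p.1 - p.2‖ ^ 2 ∂π := by
  have hX := memLp_of_map_eq measurable_fst hπ₁ hμ
  have hY := memLp_of_map_eq measurable_snd hπ₂ hν
  have hc : Continuous fun x : Euc d => ‖x - x₀‖ ^ 2 := by fun_prop
  have e₁ : sndMoment x₀ μ = ∫ p, ‖p.1 - x₀‖ ^ 2 ∂π := by
    rw [sndMoment, ← hπ₁, integral_map measurable_fst.aemeasurable hc.aestronglyMeasurable]
  have e₂ : sndMoment x₀ ν = ∫ p, ‖p.2 - x₀‖ ^ 2 ∂π := by
    rw [sndMoment, ← hπ₂, integral_map measurable_snd.aemeasurable hc.aestronglyMeasurable]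
  have i₁ := (integrable_norm_sub_sq hX (memLp_const x₀)).const_mul (a * (a - b))
  have i₂ := (integrable_norm_sub_sq hY (memLp_const x₀)).const_mul (b * (b - a))
  have i₃ := (integrable_norm_sub_sq hX hY).const_mul (a * b)
  simp only [norm_dil_sub_dil_sq]
  rw [integral_add (i₁.fun_add i₂) i₃, integral_add i₁ i₂, integral_const_mul, integral_const_mul,
    integral_const_mul, e₁, e₂]

/-- Dilating the marginals with nonnegative factors preserves optimality of a coupling. -/
theorem integral_dil_le_W2sq {μ ν : Measure (Euc d)} [IsProbabilityMeasure μ]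
    [IsProbabilityMeasure ν] (hμ : MemLp id 2 μ) (hν : MemLp id 2 ν)
    {π : Measure (Euc d × Euc d)} [IsFiniteMeasure π]
    (hπ₁ : π.map Prod.fst = μ) (hπ₂ : π.map Prod.snd = ν)
    (hopt : (∫ p, ‖p.1 - p.2‖ ^ 2 ∂π) = W2sq μ ν) (x₀ : Euc d) {a b : ℝ}
    (ha : 0 ≤ a) (hb : 0 ≤ b) :
    ∫ p, ‖dil x₀ a p.1 - dil x₀ b p.2‖ ^ 2 ∂π ≤
      W2sq (μ.map (dil x₀ a)) (ν.map (dil x₀ b)) := by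
  have hf := measurable_dil x₀ a
  have hg := measurable_dil x₀ b
  have := Measure.isProbabilityMeasure_map (μ := μ) hf.aemeasurable
  have := Measure.isProbabilityMeasure_map (μ := ν) hg.aemeasurable
  refine le_W2sq fun σ _ hσ₁ hσ₂ => ?_
  obtain ⟨ρ, hρ₁, hρ₂, rfl⟩ := exists_lift_coupling hf hg hσ₁ hσ₂
  have : IsFiniteMeasure ρ := Measure.isFiniteMeasure_of_map (hf.prodMap hg).aemeasurable
  have hc : Continuous fun p : Euc d × Euc d => ‖p.1 - p.2‖ ^ 2 := by fun_prop
  rw [integral_map (hf.prodMap hg).aemeasurable hc.aestronglyMeasurable]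
  simp only [Prod.map_fst, Prod.map_snd]
  rw [integral_norm_dil_sub_dil_sq hμ hν hπ₁ hπ₂, integral_norm_dil_sub_dil_sq hμ hν hρ₁ hρ₂, hopt]
  have hle := W2sq_map_le ρ measurable_fst measurable_snd
  rw [hρ₁, hρ₂] at hle
  gcongr

theorem norm_interp_sub_sq (t : ℝ) (x y w : Euc d) :
    ‖((1 - t) • x + t • y) - w‖ ^ 2 =
      (1 - t) * ‖x - w‖ ^ 2 + t * ‖y - w‖ ^ 2 - t * (1 - t) * ‖x - y‖ ^ 2 := by
  have h₁ : ((1 - t) • x + t • y) - w = (1 - t) • (x - w) + t • (y - w) := by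
    module
  have h₂ : x - y = (x - w) - (y - w) := by abel
  rw [h₁, h₂, norm_add_sq_real, norm_sub_sq_real (x - w), norm_smul, norm_smul, real_inner_smul_left,
    real_inner_smul_right, mul_pow, mul_pow, Real.norm_eq_abs, Real.norm_eq_abs, sq_abs, sq_abs]
  ring

/-- Positive curvature of `W₂` along the interpolation of a pair of random variables. -/
theorem W2sq_interp_ge {Ω : Type*} [MeasurableSpace Ω] [StandardBorelSpace Ω] [Nonempty Ω]
    {π : Measure Ω} [IsProbabilityMeasure π] {X Y : Ω → Euc d} (hXm : Measurable X)
    (hYm : Measurable Y) (hX : MemLp X 2 π) (hY : MemLp Y 2 π) {ν : Measure (Euc d)}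
    [IsProbabilityMeasure ν] (hν : MemLp id 2 ν) {t : ℝ} (ht₀ : 0 ≤ t) (ht₁ : t ≤ 1) :
    (1 - t) * W2sq (π.map X) ν + t * W2sq (π.map Y) ν -
        t * (1 - t) * ∫ ω, ‖X ω - Y ω‖ ^ 2 ∂π ≤
      W2sq (π.map fun ω => (1 - t) • X ω + t • Y ω) ν := by
  have hZ : Measurable fun ω => (1 - t) • X ω + t • Y ω := by fun_prop
  have := Measure.isProbabilityMeasure_map (μ := π) hZ.aemeasurable
  refine le_W2sq fun σ _ hσ₁ hσ₂ => ?_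
  obtain ⟨ρ, hρ₁, hρ₂, rfl⟩ := exists_lift_coupling hZ measurable_id hσ₁ (hσ₂.trans ν.map_id.symm)
  have hc : Continuous fun p : Euc d × Euc d => ‖p.1 - p.2‖ ^ 2 := by fun_prop
  rw [integral_map (hZ.prodMap measurable_id).aemeasurable hc.aestronglyMeasurable]
  simp only [Prod.map_fst, Prod.map_snd, id, norm_interp_sub_sq]
  have hW := memLp_of_map_eq measurable_snd hρ₂ hν
  have hX' : MemLp (fun p => X p.1) 2 ρ :=
    hX.comp_measurePreserving ⟨measurable_fst, hρ₁⟩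
  have hY' : MemLp (fun p => Y p.1) 2 ρ :=
    hY.comp_measurePreserving ⟨measurable_fst, hρ₁⟩
  have i₁ := (integrable_norm_sub_sq hX' hW).const_mul (1 - t)
  have i₂ := (integrable_norm_sub_sq hY' hW).const_mul t
  have i₃ := (integrable_norm_sub_sq hX' hY').const_mul (t * (1 - t))
  rw [integral_sub (i₁.fun_add i₂) i₃, integral_add i₁ i₂, integral_const_mul, integral_const_mul,
    integral_const_mul]
  have e : ∫ ω, ‖X ω - Y ω‖ ^ 2 ∂π = ∫ p, ‖X p.1 - Y p.1‖ ^ 2 ∂ρ := by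
    rw [← hρ₁, integral_map measurable_fst.aemeasurable]
    exact (by fun_prop : Measurable fun ω => ‖X ω - Y ω‖ ^ 2).aestronglyMeasurable
  have l₁ := W2sq_map_le ρ (hXm.comp measurable_fst) measurable_snd
  have l₂ := W2sq_map_le ρ (hYm.comp measurable_fst) measurable_snd
  rw [← Measure.map_map hXm measurable_fst, hρ₁, hρ₂] at l₁
  rw [← Measure.map_map hYm measurable_fst, hρ₁, hρ₂] at l₂
  have : 0 ≤ 1 - t := sub_nonneg.2 ht₁
  rw [e]
  gcongr
  · exact l₁
  · exact l₂

theorem isProbabilityMeasure_nm (x₀ : Euc d) (μ : Measure (Euc d)) [IsFiniteMeasure μ] :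
    IsProbabilityMeasure (nm x₀ μ) := by
  unfold nm
  split_ifs with h
  · infer_instance
  · exact ⟨by simp [ENNReal.inv_mul_cancel h (measure_ne_top μ _)]⟩

theorem memLp_id_nm (x₀ : Euc d) {μ : Measure (Euc d)} (hμ : MemM μ) :
    MemLp id 2 (nm x₀ μ) := by
  unfold nm
  split_ifs with h
  · exact memLp_id_of_integrable (integrable_dirac (by simp))
  · exact (memLp_id_of_integrable hμ.2).smul_measure (ENNReal.inv_ne_top.2 h)

theorem mass_geoCurve (μ₀ μ₁ : Measure (Euc d)) (π : Measure (Euc d × Euc d))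
    [IsProbabilityMeasure π] {t : ℝ} (hm : 0 ≤ (1 - t) * mass μ₀ + t * mass μ₁) :
    mass (geoCurve μ₀ μ₁ π t) = (1 - t) * mass μ₀ + t * mass μ₁ := by
  rw [mass, geoCurve, Measure.smul_apply, Measure.map_apply (by fun_prop) MeasurableSet.univ]
  simp [hm]

theorem nm_ofReal_smul (x₀ : Euc d) (ν : Measure (Euc d)) [IsProbabilityMeasure ν] {m : ℝ}
    (hm : 0 < m) : nm x₀ (ENNReal.ofReal m • ν) = ν := by
  have h : ENNReal.ofReal m ≠ 0 := by simpa using hm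
  rw [nm, Measure.smul_apply, measure_univ, smul_eq_mul, mul_one, if_neg h, smul_smul,
    ENNReal.inv_mul_cancel h ENNReal.ofReal_ne_top, one_smul]

theorem map_dil_nm_geoCurve (x₀ : Euc d) (μ₀ μ₁ : Measure (Euc d))
    (π : Measure (Euc d × Euc d)) [IsProbabilityMeasure π] {t : ℝ} (ht₀ : 0 ≤ t) (ht₁ : t ≤ 1) :
    (nm x₀ (geoCurve μ₀ μ₁ π t)).map (dil x₀ ((1 - t) * mass μ₀ + t * mass μ₁)) =
      π.map fun p => (1 - t) • dil x₀ (mass μ₀) p.1 + t • dil x₀ (mass μ₁) p.2 := by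
  have p₀ : 0 ≤ (1 - t) * mass μ₀ := mul_nonneg (sub_nonneg.2 ht₁) ENNReal.toReal_nonneg
  have p₁ : 0 ≤ t * mass μ₁ := mul_nonneg ht₀ ENNReal.toReal_nonneg
  rcases (add_nonneg p₀ p₁).eq_or_lt with h | h
  · have q₀ : (1 - t) * mass μ₀ = 0 := by linarith
    have q₁ : t * mass μ₁ = 0 := by linarith
    have hc : (fun p : Euc d × Euc d =>
        (1 - t) • dil x₀ (mass μ₀) p.1 + t • dil x₀ (mass μ₁) p.2) = fun _ => x₀ := by
      funext p
      simp only [dil, smul_add, smul_smul, q₀, q₁]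
      module
    rw [hc, Measure.map_const, measure_univ, one_smul, geoCurve, ← h]
    simp [nm, dil, Measure.map_dirac' (measurable_dil x₀ 0)]
  · set m := (1 - t) * mass μ₀ + t * mass μ₁ with hmdef
    have hmeas : Measurable fun p : Euc d × Euc d =>
        (1 - t * mass μ₁ / m) • p.1 + (t * mass μ₁ / m) • p.2 := by fun_prop
    have := Measure.isProbabilityMeasure_map (μ := π) hmeas.aemeasurable
    rw [geoCurve, ← hmdef, nm_ofReal_smul x₀ _ h, Measure.map_map (measurable_dil x₀ m) hmeas]
    congr 1
    funext p
    have c₁ : m * (t * mass μ₁ / m) = t * mass μ₁ := mul_div_cancel₀ _ h.ne'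
    have c₀ : m * (1 - t * mass μ₁ / m) = (1 - t) * mass μ₀ := by
      rw [mul_sub, c₁, hmdef]
      ring
    simp only [Function.comp, dil, smul_sub, smul_add, smul_smul, c₀, c₁]
    rw [hmdef]
    module

/-- `(M(ℝ^d), WOP)` has positive curvature in the sense of Alexandrov. -/
theorem WOP_positive_curvature (d : ℕ) (x₀ : Euc d) (μ₀ μ₁ : Measure (Euc d))
    (h₀ : MemM μ₀) (h₁ : MemM μ₁) (hm : 0 < mass μ₀ + mass μ₁)
    (π : Measure (Euc d × Euc d))
    (hπ₁ : π.map Prod.fst = nm x₀ μ₀) (hπ₂ : π.map Prod.snd = nm x₀ μ₁)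
    (hopt : (∫ p, ‖p.1 - p.2‖ ^ 2 ∂π) = W2sq (nm x₀ μ₀) (nm x₀ μ₁)) :
    ∀ t ∈ Set.Icc (0 : ℝ) 1, ∀ η : Measure (Euc d), MemM η →
      (1 - t) * WOP2 x₀ μ₀ η + t * WOP2 x₀ μ₁ η - t * (1 - t) * WOP2 x₀ μ₀ μ₁ ≤
        WOP2 x₀ (geoCurve μ₀ μ₁ π t) η := by
  rintro t ⟨ht₀, ht₁⟩ η hη
  have := h₀.1
  have := h₁.1
  have := hη.1
  have := isProbabilityMeasure_nm x₀ μ₀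
  have := isProbabilityMeasure_nm x₀ μ₁
  have := isProbabilityMeasure_nm x₀ η
  have : IsProbabilityMeasure (π.map Prod.fst) := hπ₁ ▸ inferInstance
  have : IsProbabilityMeasure π := Measure.isProbabilityMeasure_of_map Prod.fst
  have hμ₀ := memLp_id_nm x₀ h₀
  have hμ₁ := memLp_id_nm x₀ h₁
  have n₀ : 0 ≤ mass μ₀ := ENNReal.toReal_nonneg
  have n₁ : 0 ≤ mass μ₁ := ENNReal.toReal_nonneg
  have s : 0 ≤ 1 - t := sub_nonneg.2 ht₁
  have hη' : MemLp id 2 ((nm x₀ η).map (dil x₀ (mass η))) :=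
    (memLp_map_measure_iff continuous_id.aestronglyMeasurable
      (measurable_dil x₀ _).aemeasurable).2 (memLp_dil (memLp_id_nm x₀ hη) x₀ (mass η))
  have := Measure.isProbabilityMeasure_map (μ := nm x₀ η) (measurable_dil x₀ (mass η)).aemeasurable
  have hopt' := integral_dil_le_W2sq hμ₀ hμ₁ hπ₁ hπ₂ hopt x₀ n₀ n₁
  have hcurv := W2sq_interp_ge (π := π) ((measurable_dil x₀ (mass μ₀)).comp measurable_fst)
    ((measurable_dil x₀ (mass μ₁)).comp measurable_snd)
    (memLp_dil (memLp_of_map_eq measurable_fst hπ₁ hμ₀) x₀ (mass μ₀))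
    (memLp_dil (memLp_of_map_eq measurable_snd hπ₂ hμ₁) x₀ (mass μ₁)) hη' ht₀ ht₁
  rw [← Measure.map_map (measurable_dil x₀ _) measurable_fst,
    ← Measure.map_map (measurable_dil x₀ _) measurable_snd, hπ₁, hπ₂] at hcurv
  simp only [Function.comp] at hcurv
  have hscaled := mul_le_mul_of_nonneg_left hopt' (mul_nonneg ht₀ s)
  rw [WOP2, WOP2, WOP2, WOP2, mass_geoCurve μ₀ μ₁ π (by positivity),
    map_dil_nm_geoCurve x₀ μ₀ μ₁ π ht₀ ht₁]
  linear_combination hcurv + hscaled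

end
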